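/- arXiv:2307.15688 — 3 statements merged into one kernel-verified Lean document; each statement's English description precedes it below -/
import Mathlib

section
/- Fix n ≥ 2 and consider the uniform complete-graph Quantum Max Cut Hamiltonian H = Σ_{1 ≤ i < j ≤ n} H_{ij} on n qubits. Then the largest eigenvalue of H equals n(n+2)/8 when n is even, and equals (n+3)(n−1)/8 when n is odd. In particular, for odd n the level-1 NPA value n(n+2)/8 exceeds the true maximum eigenvalue by exactly 3/8. -/
open Matrix Finset
open scoped ComplexOrder

noncomputable section

/-- The SWAP matrix on qubits indexed by `V`, exchanging tensor factors `i` and `j`. -/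
def swapMat {V : Type*} [Fintype V] [DecidableEq V] (i j : V) :
    Matrix (V → Fin 2) (V → Fin 2) ℂ :=
  Matrix.of fun f g => if f ∘ (Equiv.swap i j) = g then 1 else 0

/-- The singlet projector `H_{ij} = (I - P_{ij})/2`. -/
def singletProj {V : Type*} [Fintype V] [DecidableEq V] (i j : V) :
    Matrix (V → Fin 2) (V → Fin 2) ℂ :=
  (2 : ℂ)⁻¹ • (1 - swapMat i j)

/-- The number of qubits in state `a` in the computational basis state `f`. -/
def levelCount {V : Type*} [Fintype V] (a : Fin 2) (f : V → Fin 2) : ℕ :=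
  #{i | f i = a}

/-- The collective ladder operator: `(flipSum a b v) f` sums `v` over all configurations obtained
from `f` by changing one qubit from `a` to `b`. -/
def flipSum {V : Type*} [Fintype V] [DecidableEq V] (a b : Fin 2) (v : (V → Fin 2) → ℂ)
    (f : V → Fin 2) : ℂ :=
  ∑ i, if f i = a then v (Function.update f i b) else 0

lemma levelCount_comp_perm {V : Type*} [Fintype V] (a : Fin 2) (f : V → Fin 2)
    (σ : Equiv.Perm V) :
    levelCount a (f ∘ σ) = levelCount a f := by
  simp only [levelCount, Finset.card_filter, Function.comp_apply]
  exact Equiv.sum_comp σ fun i => if f i = a then 1 else 0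

lemma levelCount_add {V : Type*} [Fintype V] {a b : Fin 2} (hab : a ≠ b) (f : V → Fin 2) :
    levelCount a f + levelCount b f = Fintype.card V := by
  have h : ∀ i, f i = b ↔ ¬ f i = a := fun i => by omega
  simp only [levelCount, h]
  exact Finset.card_filter_add_card_filter_not _

lemma update_update_eq_comp_swap {V : Type*} [DecidableEq V] {a b : Fin 2} {f : V → Fin 2}
    {i j : V} (hij : i ≠ j) (hi : f i = a) (hj : f j = b) :
    Function.update (Function.update f j a) i b = f ∘ Equiv.swap i j := by
  funext k
  rcases eq_or_ne k i with rfl | hki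
  · simp [hj]
  rcases eq_or_ne k j with rfl | hkj
  · simp [hki, hi]
  · simp [hki, hkj, Equiv.swap_apply_of_ne_of_ne]

lemma comp_swap_of_eq {V : Type*} [DecidableEq V] {f : V → Fin 2} {i j : V} (h : f i = f j) :
    f ∘ Equiv.swap i j = f := by
  funext k
  rcases eq_or_ne k i with rfl | hki
  · simp [h]
  rcases eq_or_ne k j with rfl | hkj
  · simp [h]
  · simp [Equiv.swap_apply_of_ne_of_ne hki hkj]

section Ladder

variable {V : Type*} [Fintype V] [DecidableEq V]

lemma flipSum_flipSum {a b : Fin 2} (hab : a ≠ b) (v : (V → Fin 2) → ℂ) (f : V → Fin 2) :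
    flipSum b a (flipSum a b v) f = ∑ j, ∑ i, ((if f j = b ∧ i = j then v f else 0) +
      if f i = a ∧ f j = b then v (f ∘ Equiv.swap i j) else 0) := by
  unfold flipSum
  refine Finset.sum_congr rfl fun j _ => ?_
  by_cases hj : f j = b
  · rw [if_pos hj]
    refine Finset.sum_congr rfl fun i _ => ?_
    rcases eq_or_ne i j with rfl | hij
    · have hupd : Function.update f i b = f := by rw [← hj, Function.update_eq_self]
      simp [hj, hupd, hab.symm]
    · by_cases hi : f i = a
      · simp [hij, hi, hj, update_update_eq_comp_swap hij hi hj]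
      · simp [hij, hi]
  · simp [hj]

lemma levelCount_mul {a b : Fin 2} (c : ℂ) (f : V → Fin 2) :
    (levelCount b f : ℂ) * (levelCount a f + 1) * c =
      ∑ j, ∑ i, ((if f j = b ∧ i = j then c else 0) + if f i = a ∧ f j = b then c else 0) := by
  have h : ∀ j, (∑ i, ((if f j = b ∧ i = j then c else 0) +
      if f i = a ∧ f j = b then c else 0)) =
      if f j = b then (levelCount a f + 1) * c else 0 := by
    intro j
    by_cases hj : f j = b
    · simp [hj, Finset.sum_add_distrib, levelCount, Finset.sum_ite]
      ring
    · simp [hj]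
  simp only [h]
  simp [levelCount, Finset.sum_ite]
  ring

/-- The swap Laplacian in terms of ladder operators. -/
lemma sum_sub_comp_swap {a b : Fin 2} (hab : a ≠ b) (v : (V → Fin 2) → ℂ) (f : V → Fin 2) :
    ∑ i, ∑ j, (v f - v (f ∘ Equiv.swap i j)) =
      2 * ((levelCount b f : ℂ) * (levelCount a f + 1) * v f
        - flipSum b a (flipSum a b v) f) := by
  let T : V → V → ℂ := fun j i => if f i = a ∧ f j = b then v f - v (f ∘ Equiv.swap i j) else 0
  have hT : (levelCount b f : ℂ) * (levelCount a f + 1) * v f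
      - flipSum b a (flipSum a b v) f = ∑ j, ∑ i, T j i := by
    rw [flipSum_flipSum hab, levelCount_mul]
    simp only [← Finset.sum_sub_distrib]
    refine Finset.sum_congr rfl fun j _ => Finset.sum_congr rfl fun i _ => ?_
    simp only [T]
    split_ifs <;> ring
  rw [hT, two_mul]
  nth_rewrite 2 [Finset.sum_comm]
  simp only [← Finset.sum_add_distrib]
  refine Finset.sum_congr rfl fun i _ => Finset.sum_congr rfl fun j _ => ?_
  simp only [T, Equiv.swap_comm j i]
  by_cases h : f i = f j
  · have h₁ : ¬ (f j = a ∧ f i = b) := fun h' => hab (by rw [← h'.1, ← h'.2, h])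
    have h₂ : ¬ (f i = a ∧ f j = b) := fun h' => hab (by rw [← h'.1, ← h'.2, h])
    simp [h₁, h₂, comp_swap_of_eq h]
  · have : (f j = a ∧ f i = b) ∧ ¬ (f i = a ∧ f j = b) ∨
        ¬ (f j = a ∧ f i = b) ∧ (f i = a ∧ f j = b) := by omega
    rcases this with ⟨h₁, h₂⟩ | ⟨h₁, h₂⟩
    · rw [if_pos h₁, if_neg h₂, zero_add]
    · rw [if_neg h₁, if_pos h₂, add_zero]

open ComplexConjugate in
/-- The raising and lowering operators are adjoint to each other. -/
lemma sum_conj_mul_flipSum (a b : Fin 2) (w u : (V → Fin 2) → ℂ) :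
    ∑ f, conj (w f) * flipSum b a u f = ∑ g, conj (flipSum a b w g) * u g := by
  simp only [flipSum, Finset.mul_sum, map_sum, Finset.sum_mul]
  rw [Finset.sum_comm]
  nth_rewrite 2 [Finset.sum_comm]
  refine Finset.sum_congr rfl fun i _ => ?_
  have h₁ : ∀ f : V → Fin 2, (conj (w f) * if f i = b then u (Function.update f i a) else 0) =
      if f i = b then conj (w f) * u (Function.update f i a) else 0 := fun f => by
    split_ifs <;> simp
  have h₂ : ∀ f : V → Fin 2, (conj (if f i = a then w (Function.update f i b) else 0) * u f) =
      if f i = a then conj (w (Function.update f i b)) * u f else 0 := fun f => by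
    split_ifs <;> simp
  simp only [h₁, h₂]
  rw [← Finset.sum_filter, ← Finset.sum_filter]
  refine Finset.sum_nbij' (fun f => Function.update f i a) (fun f => Function.update f i b)
    ?_ ?_ ?_ ?_ ?_
  · simp
  · simp
  · intro f hf
    simp only [Finset.mem_filter, Finset.mem_univ, true_and] at hf
    simp [← hf]
  · intro f hf
    simp only [Finset.mem_filter, Finset.mem_univ, true_and] at hf
    simp [← hf]
  · intro f hf
    simp only [Finset.mem_filter, Finset.mem_univ, true_and] at hf
    simp [← hf]

open ComplexConjugate in
/-- An eigenvalue of the swap Laplacian is bounded by the diagonal term of any of its two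
ladder decompositions, on the relevant half of the configurations. -/
lemma eigenvalue_le_of_levelCount_le {v : (V → Fin 2) → ℂ} (hv : v ≠ 0) {t C : ℝ}
    (ht : ∀ f, ∑ i, ∑ j, (v f - v (f ∘ Equiv.swap i j)) = 4 * (t : ℂ) * v f)
    (hC : ∀ p q : ℕ, p + q = Fintype.card V → p ≤ q → (p : ℝ) * (q + 1) ≤ 2 * C) :
    t ≤ C := by
  obtain ⟨f₀, hf₀⟩ := Function.ne_iff.mp hv
  obtain ⟨a, b, hab, hle⟩ : ∃ a b : Fin 2, a ≠ b ∧ levelCount b f₀ ≤ levelCount a f₀ := by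
    rcases le_total (levelCount 1 f₀) (levelCount 0 f₀) with h | h
    · exact ⟨0, 1, by decide, h⟩
    · exact ⟨1, 0, by decide, h⟩
  let w : (V → Fin 2) → ℂ := fun f => if levelCount b f ≤ levelCount a f then v f else 0
  have hw : ∀ f, ∑ i, ∑ j, (w f - w (f ∘ Equiv.swap i j)) = 4 * (t : ℂ) * w f := by
    intro f
    simp only [w, levelCount_comp_perm]
    split_ifs with h
    · exact ht f
    · simp
  have hpoint : ∀ f, 2 * (t : ℂ) * w f = (levelCount b f : ℂ) * (levelCount a f + 1) * w f
        - flipSum b a (flipSum a b w) f := by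
    intro f
    have h := hw f
    rw [sum_sub_comp_swap hab] at h
    linear_combination -h / 2
  have hsq : ∀ z : ℂ, conj z * z = ((‖z‖ ^ 2 : ℝ) : ℂ) := fun z => by
    rw [Complex.conj_mul']; push_cast; rfl
  have hsum : 2 * t * ∑ f, ‖w f‖ ^ 2 =
      ∑ f, (levelCount b f : ℝ) * (levelCount a f + 1) * ‖w f‖ ^ 2
        - ∑ f, ‖flipSum a b w f‖ ^ 2 := by
    have h : ∑ f, conj (w f) * (2 * (t : ℂ) * w f) =
        ∑ f, conj (w f) * ((levelCount b f : ℂ) * (levelCount a f + 1) * w f)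
          - ∑ f, conj (w f) * flipSum b a (flipSum a b w) f := by
      rw [← Finset.sum_sub_distrib]
      exact Finset.sum_congr rfl fun f _ => by rw [hpoint f, mul_sub]
    rw [sum_conj_mul_flipSum] at h
    have h' : ∀ c z : ℂ, conj z * (c * z) = c * (conj z * z) := fun c z => by ring
    simp only [h', hsq, ← Finset.mul_sum] at h
    exact_mod_cast h
  have hpos : 0 < ∑ f, ‖w f‖ ^ 2 := by
    refine Finset.sum_pos' (fun f _ => by positivity) ⟨f₀, Finset.mem_univ _, ?_⟩
    have : w f₀ ≠ 0 := by simpa [w, hle] using hf₀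
    positivity
  have hbound : ∑ f, (levelCount b f : ℝ) * (levelCount a f + 1) * ‖w f‖ ^ 2 ≤
      2 * C * ∑ f, ‖w f‖ ^ 2 := by
    rw [Finset.mul_sum]
    refine Finset.sum_le_sum fun f _ => ?_
    by_cases h : levelCount b f ≤ levelCount a f
    · exact mul_le_mul_of_nonneg_right (hC _ _ (levelCount_add hab.symm f) h) (by positivity)
    · simp [w, h]
  have hnonneg : 0 ≤ ∑ f, ‖flipSum a b w f‖ ^ 2 := Finset.sum_nonneg fun f _ => by positivity
  have : 2 * t * ∑ f, ‖w f‖ ^ 2 ≤ 2 * C * ∑ f, ‖w f‖ ^ 2 := by linarith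
  linarith [le_of_mul_le_mul_right this hpos]

end Ladder

section Singlets

variable {V : Type*} [DecidableEq V] {τ : V → V} {v : (V → Fin 2) → ℂ}

lemma eq_zero_of_antisymm (hanti : ∀ i, τ i ≠ i → ∀ f, v (f ∘ Equiv.swap i (τ i)) = -v f)
    {i : V} (hi : τ i ≠ i) {f : V → Fin 2} (hf : f i = f (τ i)) : v f = 0 := by
  have h := hanti i hi f
  rw [comp_swap_of_eq hf] at h
  exact self_eq_neg.mp h

/-- A product of singlets along the pairs of an involution, with the fixed points in state `0`,
is annihilated by the ladder operator turning zeros into ones. -/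
lemma flipSum_eq_zero_of_antisymm [Fintype V] (hτ : ∀ i, τ (τ i) = i)
    (hanti : ∀ i, τ i ≠ i → ∀ f, v (f ∘ Equiv.swap i (τ i)) = -v f)
    (hfix : ∀ i, τ i = i → ∀ f, f i = 1 → v f = 0) : flipSum 0 1 v = 0 := by
  funext f
  refine Finset.sum_involution (fun i _ => τ i) ?_ ?_ (fun _ _ => Finset.mem_univ _)
    fun i _ => hτ i
  · intro i _
    by_cases hi : τ i = i
    · simp [hi, hfix i hi (Function.update f i 1) (by simp)]
    have hi' : i ≠ τ i := Ne.symm hi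
    have hcases : ∀ x : Fin 2, x = 0 ∨ x = 1 := by decide
    rcases hcases (f i) with h | h <;> rcases hcases (f (τ i)) with h' | h'
    · have := hanti i hi (Function.update f i 1)
      have hswap : Function.update f i 1 ∘ Equiv.swap i (τ i) = Function.update f (τ i) 1 := by
        funext k
        rcases eq_or_ne k i with rfl | hki
        · simp [hi, hi', h, h']
        rcases eq_or_ne k (τ i) with rfl | hkj
        · simp
        · simp [hki, hkj, Equiv.swap_apply_of_ne_of_ne]
      rw [hswap] at this
      simp [h, h', this]
    · simp [h, h', eq_zero_of_antisymm hanti hi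
        (show Function.update f i 1 i = Function.update f i 1 (τ i) by simp [hi, h'])]
    · simp [h, h', eq_zero_of_antisymm hanti hi
        (show Function.update f (τ i) 1 i = Function.update f (τ i) 1 (τ i) by simp [hi', h])]
    · simp [h, h']
  · intro i _ hne hi
    simp [hfix i hi (Function.update f i 1) (by simp)] at hne

lemma two_mul_levelCount_of_antisymm [Fintype V] (hτ : ∀ i, τ (τ i) = i)
    (hanti : ∀ i, τ i ≠ i → ∀ f, v (f ∘ Equiv.swap i (τ i)) = -v f)
    (hfix : ∀ i, τ i = i → ∀ f, f i = 1 → v f = 0) {f : V → Fin 2} (hf : v f ≠ 0) :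
    2 * levelCount 1 f + #{i | τ i = i} = Fintype.card V := by
  have key : ∑ i, ((if f i = 1 then (2 : ℤ) else 0) + (if τ i = i then 1 else 0) - 1) = 0 := by
    have hcases : ∀ x : Fin 2, x = 0 ∨ x = 1 := by decide
    refine Finset.sum_involution (fun i _ => τ i) ?_ ?_ (fun _ _ => Finset.mem_univ _)
      fun i _ => hτ i
    · intro i _
      by_cases hi : τ i = i
      · have : f i ≠ 1 := fun h => hf (hfix i hi f h)
        simp [hi, this]
      · have hne : f i ≠ f (τ i) := fun h => hf (eq_zero_of_antisymm hanti hi h)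
        rcases hcases (f i) with h | h <;> rcases hcases (f (τ i)) with h' | h'
        · exact absurd (h.trans h'.symm) hne
        · simp [hτ, h, h', hi, Ne.symm hi]
        · simp [hτ, h, h', hi, Ne.symm hi]
        · exact absurd (h.trans h'.symm) hne
    · intro i _ hne hi
      have : f i ≠ 1 := fun h => hf (hfix i hi f h)
      simp [hi, this] at hne
  rw [Finset.sum_sub_distrib, Finset.sum_add_distrib] at key
  simp only [Finset.sum_ite, Finset.sum_const, Finset.card_univ, nsmul_eq_mul] at key
  simp only [levelCount]
  zify
  linarith

end Singlets

/-- The involution of `Fin n` exchanging `2k` and `2k + 1`. -/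
def pairing {n : ℕ} (i : Fin n) : Fin n :=
  if i.val % 2 = 1 then ⟨i.val - 1, by omega⟩
  else if h : i.val + 1 < n then ⟨i.val + 1, h⟩ else i

lemma pairing_val {n : ℕ} (i : Fin n) : (pairing i).val =
    if i.val % 2 = 1 then i.val - 1 else if i.val + 1 < n then i.val + 1 else i.val := by
  unfold pairing
  split_ifs <;> rfl

lemma pairing_pairing {n : ℕ} (i : Fin n) : pairing (pairing i) = i := by
  have h₁ := pairing_val i
  have h₂ := pairing_val (pairing i)
  apply Fin.ext
  split_ifs at h₁ h₂ <;> omega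

lemma card_pairing_fixed (n : ℕ) : #{i : Fin n | pairing i = i} = n % 2 := by
  rcases Nat.mod_two_eq_zero_or_one n with h | h
  · rw [h, Finset.card_eq_zero, Finset.filter_eq_empty_iff]
    intro i _ hi
    have h₁ := pairing_val i
    rw [hi] at h₁
    split_ifs at h₁ <;> omega
  · rw [h, Finset.card_eq_one]
    refine ⟨⟨n - 1, by omega⟩, ?_⟩
    ext i
    have h₁ := pairing_val i
    simp only [Finset.mem_filter, Finset.mem_univ, true_and, Finset.mem_singleton, Fin.ext_iff]
    split_ifs at h₁ <;> omega

/-- The amplitudes of the singlet state of two qubits. -/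
def singletAmp (x y : Fin 2) : ℂ := if x = y then 0 else if y = 1 then 1 else -1

lemma singletAmp_swap (x y : Fin 2) : singletAmp y x = -singletAmp x y := by
  fin_cases x <;> fin_cases y <;> simp [singletAmp]

/-- The local factor at `i` of the product of singlets on the pairs `{2k, 2k + 1}`, where an
unpaired last qubit is in state `0`. -/
def singletFactor {n : ℕ} (f : Fin n → Fin 2) (i : Fin n) : ℂ :=
  if i.val % 2 = 1 then singletAmp (f (pairing i)) (f i)
  else if pairing i = i then (if f i = 0 then 1 else 0) else 1

/-- The product of singlets on the pairs `{2k, 2k + 1}`. -/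
def singletProd {n : ℕ} (f : Fin n → Fin 2) : ℂ := ∏ i, singletFactor f i

lemma singletProd_ne_zero (n : ℕ) : (singletProd : (Fin n → Fin 2) → ℂ) ≠ 0 := by
  refine Function.ne_iff.mpr ⟨fun i => if i.val % 2 = 1 then 1 else 0, ?_⟩
  refine Finset.prod_ne_zero_iff.mpr fun i _ => ?_
  have h₁ := pairing_val i
  unfold singletFactor
  by_cases hi : i.val % 2 = 1
  · rw [if_pos hi] at h₁
    have h₂ : ¬ (pairing i).val % 2 = 1 := by omega
    simp [hi, h₂, singletAmp]
  · simp [hi]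

lemma singletProd_eq_zero_of_fixed {n : ℕ} (i : Fin n) (hi : pairing i = i) (f : Fin n → Fin 2)
    (hf : f i = 1) : singletProd f = 0 := by
  refine Finset.prod_eq_zero (Finset.mem_univ i) ?_
  have h₁ := pairing_val i
  have h₂ : ¬ i.val % 2 = 1 := by
    intro h
    rw [if_pos h, hi] at h₁
    omega
  simp [singletFactor, h₂, hi, hf]

lemma singletProd_comp_swap_of_odd {n : ℕ} (i : Fin n) (hi : i.val % 2 = 1)
    (f : Fin n → Fin 2) : singletProd (f ∘ Equiv.swap i (pairing i)) = -singletProd f := by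
  have h₁ := pairing_val i
  rw [if_pos hi] at h₁
  have hfactor : ∀ j, singletFactor (f ∘ Equiv.swap i (pairing i)) j =
      (if j = i then -1 else 1) * singletFactor f j := by
    intro j
    have h₂ := pairing_val j
    rcases eq_or_ne j i with rfl | hji
    · simp [singletFactor, hi, singletAmp_swap (f (pairing j)) (f j)]
    have hval : j.val ≠ i.val := fun h => hji (Fin.ext h)
    by_cases hj : j.val % 2 = 1
    · rw [if_pos hj] at h₂
      have e₁ : j ≠ pairing i := fun h => by rw [Fin.ext_iff] at h; omega
      have e₂ : pairing j ≠ i := fun h => by rw [Fin.ext_iff] at h; omega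
      have e₃ : pairing j ≠ pairing i := fun h => by rw [Fin.ext_iff] at h; omega
      simp [singletFactor, hj, hji, Equiv.swap_apply_of_ne_of_ne hji e₁,
        Equiv.swap_apply_of_ne_of_ne e₂ e₃]
    · by_cases hfix : pairing j = j
      · have e₁ : j ≠ pairing i := fun h => by
          rw [h, pairing_pairing, ← h] at hfix
          exact hji hfix.symm
        simp [singletFactor, hj, hji, hfix, Equiv.swap_apply_of_ne_of_ne hji e₁]
      · simp [singletFactor, hj, hji, hfix]
  simp only [singletProd, hfactor, Finset.prod_mul_distrib]
  simp

lemma singletProd_comp_swap {n : ℕ} (i : Fin n) (hi : pairing i ≠ i) (f : Fin n → Fin 2) :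
    singletProd (f ∘ Equiv.swap i (pairing i)) = -singletProd f := by
  by_cases h : i.val % 2 = 1
  · exact singletProd_comp_swap_of_odd i h f
  · have h₁ := pairing_val i
    have h₂ : (pairing i).val ≠ i.val := fun h => hi (Fin.ext h)
    have h₃ : (pairing i).val % 2 = 1 := by split_ifs at h₁ <;> omega
    have := singletProd_comp_swap_of_odd (pairing i) h₃ f
    rwa [pairing_pairing, Equiv.swap_comm] at this

lemma singletProj_mulVec {V : Type*} [Fintype V] [DecidableEq V] (i j : V)
    (v : (V → Fin 2) → ℂ) (f : V → Fin 2) :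
    (singletProj i j *ᵥ v) f = 2⁻¹ * (v f - v (f ∘ Equiv.swap i j)) := by
  have : (swapMat i j *ᵥ v) f = v (f ∘ Equiv.swap i j) := by
    simp [swapMat, Matrix.mulVec, dotProduct]
  simp [singletProj, Matrix.smul_mulVec, Matrix.sub_mulVec, this]

/-- The complete-graph Hamiltonian acts as a quarter of the swap Laplacian. -/
lemma sum_singletProj_mulVec {n : ℕ} (v : (Fin n → Fin 2) → ℂ) (f : Fin n → Fin 2) :
    ((∑ i : Fin n, ∑ j ∈ Finset.Ioi i, singletProj i j) *ᵥ v) f =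
      4⁻¹ * ∑ i, ∑ j, (v f - v (f ∘ Equiv.swap i j)) := by
  have h := Finset.sum_sum_Ioi_add_eq_sum_sum_off_diag
    fun i j : Fin n => v f - v (f ∘ Equiv.swap j i)
  have hdiag : ∀ i : Fin n, ∑ j ∈ ({i}ᶜ : Finset (Fin n)), (v f - v (f ∘ Equiv.swap i j)) =
      ∑ j, (v f - v (f ∘ Equiv.swap i j)) := by
    intro i
    refine Finset.sum_subset (Finset.subset_univ _) fun j _ hj => ?_
    have : j = i := by simpa using hj
    subst this
    simp
  simp only [hdiag] at h
  rw [← h]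
  simp only [Matrix.sum_mulVec, Finset.sum_apply, singletProj_mulVec, Finset.mul_sum]
  refine Finset.sum_congr rfl fun i _ => Finset.sum_congr rfl fun j _ => ?_
  rw [Equiv.swap_comm j i]
  ring

lemma iSup_eigenvalues_eq {n : ℕ}
    (hH : (∑ i : Fin n, ∑ j ∈ Finset.Ioi i, singletProj i j).IsHermitian) {C : ℝ}
    (hC : ∀ p q : ℕ, p + q = n → p ≤ q → (p : ℝ) * (q + 1) ≤ 2 * C)
    (hmax : ((n / 2 : ℕ) : ℝ) * ((n - n / 2 : ℕ) + 1) = 2 * C) :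
    (⨆ y, hH.eigenvalues y) = C := by
  have hle : ∀ y, hH.eigenvalues y ≤ C := by
    intro y
    refine eigenvalue_le_of_levelCount_le (v := hH.eigenvectorBasis y) ?_ ?_
      (by simpa using hC)
    · intro h
      have h' := hH.eigenvectorBasis.orthonormal.ne_zero y
      exact h' (by ext f; exact congrFun h f)
    · intro f
      have h := congrFun (hH.mulVec_eigenvectorBasis y) f
      rw [sum_singletProj_mulVec] at h
      simp only [Pi.smul_apply, Complex.real_smul] at h
      linear_combination 4 * h
  have hmul : (∑ i : Fin n, ∑ j ∈ Finset.Ioi i, singletProj i j) *ᵥ singletProd =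
      (C : ℂ) • singletProd := by
    funext f
    rw [sum_singletProj_mulVec, sum_sub_comp_swap (a := 0) (b := 1) (by decide),
      flipSum_eq_zero_of_antisymm pairing_pairing singletProd_comp_swap
        singletProd_eq_zero_of_fixed]
    have hzero : flipSum 1 0 (0 : (Fin n → Fin 2) → ℂ) f = 0 := by simp [flipSum]
    rw [hzero, Pi.smul_apply, smul_eq_mul]
    by_cases hf : singletProd f = 0
    · simp [hf]
    have h₁ := two_mul_levelCount_of_antisymm pairing_pairing singletProd_comp_swap
      singletProd_eq_zero_of_fixed hf
    have h₂ := levelCount_add (show (0 : Fin 2) ≠ 1 by decide) f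
    rw [card_pairing_fixed, Fintype.card_fin] at h₁
    rw [Fintype.card_fin] at h₂
    rw [show levelCount 1 f = n / 2 by omega, show levelCount 0 f = n - n / 2 by omega]
    have h₃ : ((n / 2 : ℕ) : ℂ) * ((n - n / 2 : ℕ) + 1) = 2 * C := by exact_mod_cast hmax
    linear_combination 2⁻¹ * singletProd f * h₃
  have hmem : C ∈ Set.range hH.eigenvalues := by
    rw [← hH.spectrum_real_eq_range_eigenvalues, ← spectrum.algebraMap_mem_iff ℂ,
      ← Matrix.spectrum_toLin', ← Module.End.hasEigenvalue_iff_mem_spectrum]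
    exact Module.End.hasEigenvalue_of_hasEigenvector
      (x := singletProd) ⟨Module.End.mem_eigenspace_iff.mpr
        (by rw [Matrix.toLin'_apply]; exact hmul),
        singletProd_ne_zero n⟩
  obtain ⟨y, hy⟩ := hmem
  exact le_antisymm (ciSup_le hle) (hy ▸ le_ciSup (Set.finite_range _).bddAbove y)

/-- The largest eigenvalue of the uniform complete-graph Quantum Max Cut Hamiltonian
`Σ_{i<j} H_{ij}` on `n` qubits is `n(n+2)/8` for even `n` and `(n+3)(n−1)/8` for odd `n`;
in particular for odd `n` the level-1 NPA value `n(n+2)/8` exceeds the true maximum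
eigenvalue by exactly `3/8`. -/
theorem stmt15 (n : ℕ) (hn : 2 ≤ n)
    (hH : (∑ i : Fin n, ∑ j ∈ Finset.Ioi i, singletProj i j).IsHermitian) :
    (Even n → (⨆ y, hH.eigenvalues y) = (n : ℝ) * ((n : ℝ) + 2) / 8) ∧
    (Odd n → (⨆ y, hH.eigenvalues y) = ((n : ℝ) + 3) * ((n : ℝ) - 1) / 8) ∧
    (Odd n → (n : ℝ) * ((n : ℝ) + 2) / 8 - (⨆ y, hH.eigenvalues y) = 3 / 8) := by
  have heven : Even n → (⨆ y, hH.eigenvalues y) = (n : ℝ) * ((n : ℝ) + 2) / 8 := by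
    rintro ⟨m, rfl⟩
    apply iSup_eigenvalues_eq
    · intro p q hpq hle
      have hp : (p : ℝ) ≤ m := by exact_mod_cast (by omega : p ≤ m)
      have hq : (q : ℝ) = m + m - p := by
        rw [eq_sub_iff_add_eq']
        exact_mod_cast hpq
      rw [hq]
      push_cast
      nlinarith [sq_nonneg ((m : ℝ) - p)]
    · rw [show (m + m) / 2 = m by omega, show m + m - m = m by omega]
      push_cast
      ring
  have hodd : Odd n → (⨆ y, hH.eigenvalues y) = ((n : ℝ) + 3) * ((n : ℝ) - 1) / 8 := by
    rintro ⟨m, rfl⟩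
    apply iSup_eigenvalues_eq
    · intro p q hpq hle
      have hp : (p : ℝ) ≤ m := by exact_mod_cast (by omega : p ≤ m)
      have hq : (q : ℝ) = 2 * m + 1 - p := by
        rw [eq_sub_iff_add_eq']
        exact_mod_cast hpq
      rw [hq]
      push_cast
      nlinarith [sq_nonneg ((m : ℝ) - p)]
    · rw [show (2 * m + 1) / 2 = m by omega, show 2 * m + 1 - m = m + 1 by omega]
      push_cast
      ring
  refine ⟨heven, hodd, fun h => ?_⟩
  rw [hodd h]
  ring

end
end

section
/- Let R be an associative unital ℚ-algebra, let i, j, k, l be four distinct indices, and let elements h_e ∈ R, indexed by the six unordered pairs among {i,j,k,l}, satisfy the singlet-projector relations (restricted to these indices). Then the degree-reduction identity holds: h_{ij} h_{jk} h_{kl} = (1/4)·(h_{ij} h_{jk} + h_{jk} h_{kl} + h_{ij} h_{kl} + h_{ik} h_{jl} − h_{ij} h_{jl} − h_{ik} h_{kl} − h_{il} h_{jk}). -/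
/-- If `x` is idempotent and `x, y, z` are the projectors of the three edges of a triangle, then
`x * (y + z) = x / 2` and `(y + z) * x = x / 2`. -/
theorem mul_add_mul_eq_half {R : Type*} [Ring R] [Algebra ℚ R] {x y z : R} (hx : x ^ 2 = x)
    (hy : x * y + y * x = (1/2 : ℚ) • (x + y - z))
    (hz : x * z + z * x = (1/2 : ℚ) • (x + z - y)) :
    x * y + x * z = (1/2 : ℚ) • x ∧ y * x + z * x = (1/2 : ℚ) • x := by
  have hx' : x * x = x := by rw [← sq, hx]
  have hl := congrArg (x * ·) hy
  have hr := congrArg (· * x) hy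
  simp only [mul_add, add_mul, mul_sub, sub_mul, mul_smul_comm, smul_mul_assoc, mul_assoc,
    hx'] at hl hr
  simp only [← mul_assoc, hx'] at hl hr
  constructor
  · linear_combination (norm := module) (1 : ℚ) • hl - (1 : ℚ) • hr + (1/2 : ℚ) • hy + (1/2 : ℚ) • hz
  · linear_combination (norm := module) (1 : ℚ) • hr - (1 : ℚ) • hl + (1/2 : ℚ) • hy + (1/2 : ℚ) • hz


/-- Degree-reduction identity: if elements `h a b` of an associative unital ℚ-algebra,
indexed by the unordered pairs among four distinct indices `0,1,2,3 = i,j,k,l`, satisfy the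
singlet-projector relations, then
`h_{ij} h_{jk} h_{kl} = (1/4)(h_{ij}h_{jk} + h_{jk}h_{kl} + h_{ij}h_{kl} + h_{ik}h_{jl}
  − h_{ij}h_{jl} − h_{ik}h_{kl} − h_{il}h_{jk})`. -/
theorem stmt17 {R : Type*} [Ring R] [Algebra ℚ R]
    (h : Fin 4 → Fin 4 → R)
    (hsymm : ∀ a b, h a b = h b a)
    (hidem : ∀ a b, a ≠ b → (h a b) ^ 2 = h a b)
    (hcomm : ∀ a b c d, a ≠ b → c ≠ d → a ≠ c → a ≠ d → b ≠ c → b ≠ d →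
      h a b * h c d = h c d * h a b)
    (hanti : ∀ a b c, a ≠ b → b ≠ c → a ≠ c →
      h a b * h b c + h b c * h a b = (1/2 : ℚ) • (h a b + h b c - h a c)) :
    h 0 1 * h 1 2 * h 2 3 =
      (1/4 : ℚ) • (h 0 1 * h 1 2 + h 1 2 * h 2 3 + h 0 1 * h 2 3 + h 0 2 * h 1 3
        - h 0 1 * h 1 3 - h 0 2 * h 2 3 - h 0 3 * h 1 2) := by
  have half (p q r : Fin 4) (hpq : p ≠ q) (hqr : q ≠ r) (hpr : p ≠ r) :
      h p q * h q r + h p q * h p r = (1/2 : ℚ) • h p q ∧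
        h q r * h p q + h p r * h p q = (1/2 : ℚ) • h p q := by
    refine mul_add_mul_eq_half (hidem p q hpq) (hanti p q r hpq hqr hpr) ?_
    have H := hanti q p r hpq.symm hpr hqr
    rwa [hsymm q p] at H
  have ab := hanti 0 1 2 (by decide) (by decide) (by decide)
  have bc := hanti 1 2 3 (by decide) (by decide) (by decide)
  have ae := hanti 0 1 3 (by decide) (by decide) (by decide)
  have dc := hanti 0 2 3 (by decide) (by decide) (by decide)
  have ac := hcomm 0 1 2 3 (by decide) (by decide) (by decide) (by decide) (by decide) (by decide)
  have de := hcomm 0 2 1 3 (by decide) (by decide) (by decide) (by decide) (by decide) (by decide)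
  have fb := hcomm 0 3 1 2 (by decide) (by decide) (by decide) (by decide) (by decide) (by decide)
  have a_bd := (half 0 1 2 (by decide) (by decide) (by decide)).1
  have b_ce := (half 1 2 3 (by decide) (by decide) (by decide)).1
  have b_da := (half 1 2 0 (by decide) (by decide) (by decide)).1
  have ba_d := (half 0 2 1 (by decide) (by decide) (by decide)).2
  simp only [hsymm 1 0, hsymm 2 0, hsymm 2 1] at b_da ba_d
  generalize h 0 1 = a at *
  generalize h 1 2 = b at *
  generalize h 2 3 = c at *
  generalize h 0 2 = d at *
  generalize h 1 3 = e at *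
  generalize h 0 3 = f at *
  have a_bc := congrArg (a * ·) bc
  have c_ab := congrArg (c * ·) ab
  have bc_a := congrArg (· * a) bc
  have b_dc := congrArg (b * ·) dc
  have a_b_ce := congrArg (a * ·) b_ce
  have a_bd_e := congrArg (· * e) a_bd
  have ba_d_e := congrArg (· * e) ba_d
  have b_ce_d := congrArg (· * d) b_ce
  have b_da_c := congrArg (· * c) b_da
  have b_de := congrArg (b * ·) de
  have b_ac := congrArg (b * ·) ac
  have ac_b := congrArg (· * b) ac
  simp only [mul_add, add_mul, mul_sub, sub_mul, mul_smul_comm, smul_mul_assoc, mul_assoc]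
    at a_bc c_ab bc_a b_dc a_b_ce a_bd_e ba_d_e b_ce_d b_da_c b_de b_ac ac_b ⊢
  linear_combination (norm := module)
    (1/4 : ℚ) • ab + (-1/4 : ℚ) • bc + (-1/4 : ℚ) • ae + (1/4 : ℚ) • dc + (1/4 : ℚ) • fb +
    (1/2 : ℚ) • a_bc + (-1/2 : ℚ) • c_ab + (1/2 : ℚ) • bc_a + (1/2 : ℚ) • b_dc + (1/2 : ℚ) •
    a_b_ce + (-1/2 : ℚ) • a_bd_e + (1/2 : ℚ) • ba_d_e + (-1/2 : ℚ) • b_ce_d + (-1/2 : ℚ) •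
    b_da_c + (-1/2 : ℚ) • b_de + (1/2 : ℚ) • b_ac + (-1/2 : ℚ) • ac_b
end

section
/- Fix L ≥ 5 and consider L qubits with sites indexed by ℤ/Lℤ (indices taken modulo L). Let H = Σ_{i=1}^L (H_{i,i+1} + (1/2)·H_{i,i+2}) be the Majumdar–Ghosh Hamiltonian (the J₁–J₂ Heisenberg chain at J₂/J₁ = 1/2 with periodic boundary conditions, in the Quantum Max Cut convention). Then the sum-of-squares matrix identity holds: (3L/4)·I − H = Σ_{k=1}^L (3/4)·(I − (2/3)·(H_{k,k+1} + H_{k+1,k+2} + H_{k,k+2}))². In particular λ_max(H) ≤ 3L/4, and for even L ≥ 6 equality λ_max(H) = 3L/4 is attained (by the dimer singlet-product states). -/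
open Matrix Finset
open scoped ComplexOrder

noncomputable section

/-- The Majumdar–Ghosh Hamiltonian `Σ_i (H_{i,i+1} + (1/2) H_{i,i+2})` on `L` qubits with
periodic boundary conditions (sites indexed by `ZMod L`). -/
def mgHam (L : ℕ) [NeZero L] :
    Matrix (ZMod L → Fin 2) (ZMod L → Fin 2) ℂ :=
  ∑ i : ZMod L, (singletProj i (i + 1) + (2 : ℂ)⁻¹ • singletProj i (i + 2))

section Swap

variable {V : Type*} [Fintype V] [DecidableEq V]

theorem swapMat_mulVec (i j : V) (v : (V → Fin 2) → ℂ) :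
    swapMat i j *ᵥ v = fun f => v (f ∘ Equiv.swap i j) := by
  ext f
  simp [swapMat, mulVec, dotProduct]

theorem swapMat_comm (i j : V) : swapMat i j = swapMat j i := by
  simp only [swapMat, Equiv.swap_comm]

theorem swapMat_mul_self (i j : V) : swapMat i j * swapMat i j = 1 := by
  refine Matrix.ext_of_mulVec_single fun g => ?_
  rw [← mulVec_mulVec, swapMat_mulVec, swapMat_mulVec, one_mulVec]
  ext f
  simp [Function.comp_assoc, ← Equiv.coe_trans]

theorem swapMat_isHermitian (i j : V) : (swapMat i j).IsHermitian := by
  ext f g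
  have : g ∘ Equiv.swap i j = f ↔ f ∘ Equiv.swap i j = g := by
    constructor <;> rintro rfl <;> ext x <;> simp
  simp [swapMat, conjTranspose_apply, this, apply_ite]

theorem swapMat_mul_swapMat {a b c : V} (hab : a ≠ b) (hbc : b ≠ c) (hac : a ≠ c) :
    swapMat a b * swapMat b c = swapMat a c * swapMat a b := by
  refine Matrix.ext_of_mulVec_single fun g => ?_
  simp only [← mulVec_mulVec, swapMat_mulVec]
  ext f
  congr 1
  ext x
  simp only [Function.comp_apply, Equiv.swap_apply_def]
  grind

/-- The antisymmetrizer on three qubits vanishes. -/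
theorem swapMat_mul_add_mul {a b c : V} (hab : a ≠ b) (hbc : b ≠ c) (hac : a ≠ c) :
    swapMat a b * swapMat b c + swapMat b c * swapMat a b
      = swapMat a b + swapMat b c + swapMat a c - 1 := by
  refine Matrix.ext_of_mulVec_single fun g => ?_
  simp only [add_mulVec, sub_mulVec, one_mulVec, ← mulVec_mulVec, swapMat_mulVec]
  generalize (Pi.single g 1 : (V → Fin 2) → ℂ) = v
  ext f
  simp only [Pi.add_apply, Pi.sub_apply]
  have key : f a = f b ∨ f b = f c ∨ f a = f c := by omega
  have self_swap (i j : V) (hij : f i = f j) : f ∘ Equiv.swap i j = f := by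
    ext x
    simp only [Function.comp_apply, Equiv.swap_apply_def]
    grind
  rcases key with h | h | h
  · have h1 : (f ∘ Equiv.swap a b) ∘ Equiv.swap b c = f ∘ Equiv.swap b c := by
      rw [self_swap a b h]
    have h2 : (f ∘ Equiv.swap b c) ∘ Equiv.swap a b = f ∘ Equiv.swap a c := by
      ext x
      simp only [Function.comp_apply, Equiv.swap_apply_def]
      grind
    rw [h1, h2, self_swap a b h]
    ring
  · have h1 : (f ∘ Equiv.swap a b) ∘ Equiv.swap b c = f ∘ Equiv.swap a c := by
      ext x
      simp only [Function.comp_apply, Equiv.swap_apply_def]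
      grind
    have h2 : (f ∘ Equiv.swap b c) ∘ Equiv.swap a b = f ∘ Equiv.swap a b := by
      rw [self_swap b c h]
    rw [h1, h2, self_swap b c h]
    ring
  · have h1 : (f ∘ Equiv.swap a b) ∘ Equiv.swap b c = f ∘ Equiv.swap a b := by
      ext x
      simp only [Function.comp_apply, Equiv.swap_apply_def]
      grind
    have h2 : (f ∘ Equiv.swap b c) ∘ Equiv.swap a b = f ∘ Equiv.swap b c := by
      ext x
      simp only [Function.comp_apply, Equiv.swap_apply_def]
      grind
    rw [h1, h2, self_swap a c h]
    ring

/-- The sum of singlet projectors on a triangle -/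
theorem singletProj_triangle_sq {a b c : V} (hab : a ≠ b) (hbc : b ≠ c) (hac : a ≠ c) :
    (singletProj a b + singletProj b c + singletProj a c) ^ 2
      = (3 / 2 : ℂ) • (singletProj a b + singletProj b c + singletProj a c) := by
  have h1 := swapMat_mul_add_mul hab hbc hac
  have h2 := swapMat_mul_add_mul hac hbc.symm hab
  have h3 := swapMat_mul_add_mul hab.symm hac hbc
  rw [swapMat_comm c b] at h2
  rw [swapMat_comm b a] at h3
  have e1 := swapMat_mul_self a b
  have e2 := swapMat_mul_self b c
  have e3 := swapMat_mul_self a c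
  simp only [singletProj]
  generalize swapMat a b = A at *
  generalize swapMat b c = B at *
  generalize swapMat a c = C at *
  have hT : (A + B + C) ^ 2 = (3 : ℂ) • (A + B + C) := by
    have : (A + B + C) ^ 2 = A * A + B * B + C * C + (A * B + B * A) + (C * B + B * C)
      + (A * C + C * A) := by noncomm_ring
    rw [this, h1, h2, h3, e1, e2, e3]
    module
  have hS : (2 : ℂ)⁻¹ • (1 - A) + (2 : ℂ)⁻¹ • (1 - B) + (2 : ℂ)⁻¹ • (1 - C)
      = (2 : ℂ)⁻¹ • ((3 : ℂ) • 1 - (A + B + C)) := by module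
  rw [hS]
  generalize A + B + C = T at *
  rw [pow_two] at *
  simp only [sub_mul, mul_sub, hT, smul_mul_assoc, mul_smul_comm, one_mul, mul_one]
  module

theorem sum_swapMat_mulVec_eq_zero {a b c : V} (hab : a ≠ b) (hbc : b ≠ c) (hac : a ≠ c)
    {v : (V → Fin 2) → ℂ} (hv : swapMat a b *ᵥ v = -v) :
    (swapMat a b + swapMat b c + swapMat a c) *ᵥ v = 0 := by
  have h := congrArg (· *ᵥ v) (swapMat_mul_add_mul hab hbc hac)
  rw [swapMat_mul_swapMat hab hbc hac] at h
  simp only [add_mulVec, sub_mulVec, one_mulVec, ← mulVec_mulVec, hv, mulVec_neg] at h ⊢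
  ext f
  have := congrFun h f
  simp only [Pi.add_apply, Pi.sub_apply, Pi.neg_apply, Pi.zero_apply] at this ⊢
  linear_combination (-1 / 2) * this

end Swap

section MajumdarGhosh

theorem ZMod.ne_add_one_ne_add_two {L : ℕ} (hL : 5 ≤ L) (k : ZMod L) :
    k ≠ k + 1 ∧ k + 1 ≠ k + 2 ∧ k ≠ k + 2 := by
  have h1 : (1 : ZMod L) ≠ 0 := by
    have := (ZMod.natCast_eq_zero_iff 1 L).not.mpr (Nat.not_dvd_of_pos_of_lt one_pos (by omega))
    exact_mod_cast this
  have h2 : (2 : ZMod L) ≠ 0 := by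
    have := (ZMod.natCast_eq_zero_iff 2 L).not.mpr (Nat.not_dvd_of_pos_of_lt two_pos (by omega))
    exact_mod_cast this
  refine ⟨by simpa using h1, fun h => h1 ?_, by simpa using h2⟩
  linear_combination -h

variable {L : ℕ} [NeZero L]

theorem mgHam_eq_sum_triangle : mgHam L = (2 : ℂ)⁻¹ • ∑ k : ZMod L,
    (singletProj k (k + 1) + singletProj (k + 1) (k + 2) + singletProj k (k + 2)) := by
  have shift : ∑ k : ZMod L, singletProj (k + 1) (k + 2)
      = ∑ k : ZMod L, singletProj k (k + 1) := by
    refine Fintype.sum_equiv (Equiv.addRight 1) _ _ fun k => ?_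
    simp [add_assoc, one_add_one_eq_two]
  simp only [mgHam, sum_add_distrib, shift, smul_add, ← smul_sum]
  module

theorem smul_one_sub_mgHam (hL : 5 ≤ L) :
    ((((3 * (L : ℝ) / 4 : ℝ)) : ℂ) • (1 : Matrix (ZMod L → Fin 2) (ZMod L → Fin 2) ℂ)
        - mgHam L
      = ∑ k : ZMod L, ((3/4 : ℝ) : ℂ) •
          ((1 : Matrix (ZMod L → Fin 2) (ZMod L → Fin 2) ℂ)
            - ((2/3 : ℝ) : ℂ) •
                (singletProj k (k + 1) + singletProj (k + 1) (k + 2)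
                  + singletProj k (k + 2))) ^ 2) := by
  have term (k : ZMod L) : ((3/4 : ℝ) : ℂ) •
      ((1 : Matrix (ZMod L → Fin 2) (ZMod L → Fin 2) ℂ) - ((2/3 : ℝ) : ℂ) •
        (singletProj k (k + 1) + singletProj (k + 1) (k + 2) + singletProj k (k + 2))) ^ 2
      = (3 / 4 : ℂ) • 1 - (2 : ℂ)⁻¹ •
        (singletProj k (k + 1) + singletProj (k + 1) (k + 2) + singletProj k (k + 2)) := by
    obtain ⟨h1, h2, h3⟩ := ZMod.ne_add_one_ne_add_two hL k
    have h := singletProj_triangle_sq h1 h2 h3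
    generalize singletProj k (k + 1) + singletProj (k + 1) (k + 2) + singletProj k (k + 2) = S at *
    push_cast
    rw [pow_two] at *
    simp only [sub_mul, mul_sub, h, smul_mul_assoc, mul_smul_comm, one_mul,
      mul_one]
    module
  simp only [term, sum_sub_distrib, sum_const, card_univ, ZMod.card, ← smul_sum]
  rw [mgHam_eq_sum_triangle]
  push_cast
  module

theorem posSemidef_smul_one_sub_mgHam (hL : 5 ≤ L) :
    ((((3 * (L : ℝ) / 4 : ℝ)) : ℂ) • (1 : Matrix (ZMod L → Fin 2) (ZMod L → Fin 2) ℂ)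
        - mgHam L).PosSemidef := by
  rw [smul_one_sub_mgHam hL]
  refine posSemidef_sum _ fun k _ => PosSemidef.smul ?_ (Complex.zero_le_real.mpr (by norm_num))
  have proj (i j : ZMod L) : (singletProj i j).IsHermitian := by
    rw [singletProj, IsHermitian, conjTranspose_smul, conjTranspose_sub, conjTranspose_one,
      (swapMat_isHermitian i j).eq]
    simp
  set Q := (1 : Matrix (ZMod L → Fin 2) (ZMod L → Fin 2) ℂ) - ((2/3 : ℝ) : ℂ) •
    (singletProj k (k + 1) + singletProj (k + 1) (k + 2) + singletProj k (k + 2)) with hQ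
  have hQh : Qᴴ = Q := by
    simp only [hQ, conjTranspose_sub, conjTranspose_one, conjTranspose_smul, conjTranspose_add,
      (proj _ _).eq, Complex.star_def, Complex.conj_ofReal]
  have := posSemidef_conjTranspose_mul_self Q
  rwa [hQh, ← pow_two] at this

/-- The (unnormalized) product of singlets on the bonds `{k, k + 1}` with `k` even. -/
def dimerState (h2 : 2 ∣ L) : (ZMod L → Fin 2) → ℂ := fun f =>
  ∏ k : ZMod L with ZMod.castHom h2 (ZMod 2) k = 0, (((f k).val : ℂ) - ((f (k + 1)).val : ℂ))

theorem dimerState_ne_zero (h2 : 2 ∣ L) : dimerState h2 ≠ 0 := by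
  intro h
  have h := congrFun h fun x => if ZMod.castHom h2 (ZMod 2) x = 0 then 0 else 1
  simp only [dimerState, Pi.zero_apply, prod_eq_zero_iff, mem_filter, mem_univ, true_and] at h
  obtain ⟨k, hk, h⟩ := h
  rw [map_add, map_one, hk, zero_add, if_pos rfl, if_neg one_ne_zero] at h
  simp at h

theorem swapMat_mulVec_dimerState (h2 : 2 ∣ L) {k : ZMod L}
    (hk : ZMod.castHom h2 (ZMod 2) k = 0) :
    swapMat k (k + 1) *ᵥ dimerState h2 = -dimerState h2 := by
  rw [swapMat_mulVec]
  ext f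
  have hmem : k ∈ ({k | ZMod.castHom h2 (ZMod 2) k = 0} : Finset (ZMod L)) :=
    mem_filter.mpr ⟨mem_univ k, hk⟩
  simp only [dimerState, Pi.neg_apply]
  rw [← mul_prod_erase _ _ hmem, ← mul_prod_erase _ _ hmem, ← neg_mul]
  congr 1
  · simp
  · refine prod_congr rfl fun j hj => ?_
    simp only [mem_erase, mem_filter, mem_univ, true_and] at hj
    obtain ⟨hjk, hj⟩ := hj
    have e1 : j ≠ k + 1 := by
      rintro rfl
      rw [map_add, map_one, hk, zero_add] at hj
      exact one_ne_zero hj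
    have e2 : j + 1 ≠ k := by
      rintro rfl
      rw [map_add, map_one, hj, zero_add] at hk
      exact one_ne_zero hk
    have e3 : j + 1 ≠ k + 1 := by simpa using hjk
    simp [Equiv.swap_apply_of_ne_of_ne hjk e1, Equiv.swap_apply_of_ne_of_ne e2 e3]

theorem mgHam_mulVec_dimerState (hL : 5 ≤ L) (h2 : 2 ∣ L) :
    mgHam L *ᵥ dimerState h2 = ((3 * (L : ℝ) / 4 : ℝ) : ℂ) • dimerState h2 := by
  have term (k : ZMod L) :
      (singletProj k (k + 1) + singletProj (k + 1) (k + 2) + singletProj k (k + 2))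
        *ᵥ dimerState h2 = (3 / 2 : ℂ) • dimerState h2 := by
    obtain ⟨d1, d2, d3⟩ := ZMod.ne_add_one_ne_add_two hL k
    have hT : (swapMat k (k + 1) + swapMat (k + 1) (k + 2) + swapMat k (k + 2))
        *ᵥ dimerState h2 = 0 := by
      have parity : ∀ x : ZMod 2, x = 0 ∨ x + 1 = 0 := by decide
      rcases parity (ZMod.castHom h2 (ZMod 2) k) with hk | hk
      · exact sum_swapMat_mulVec_eq_zero d1 d2 d3 (swapMat_mulVec_dimerState h2 hk)
      · have hk' : ZMod.castHom h2 (ZMod 2) (k + 1) = 0 := by rw [map_add, map_one, hk]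
        have hv := swapMat_mulVec_dimerState h2 hk'
        rw [add_assoc, one_add_one_eq_two] at hv
        have := sum_swapMat_mulVec_eq_zero d2 d3.symm d1.symm hv
        rw [swapMat_comm (k + 2) k, swapMat_comm (k + 1) k] at this
        rw [← this]
        congr 1
        abel
    have hS : singletProj k (k + 1) + singletProj (k + 1) (k + 2) + singletProj k (k + 2)
        = (3 / 2 : ℂ) • 1
          - (2 : ℂ)⁻¹ • (swapMat k (k + 1) + swapMat (k + 1) (k + 2) + swapMat k (k + 2)) := by
      simp only [singletProj]
      module
    rw [hS, sub_mulVec, smul_mulVec, smul_mulVec, hT, one_mulVec, smul_zero, sub_zero]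
  rw [mgHam_eq_sum_triangle, smul_mulVec, sum_mulVec]
  simp only [term, sum_const, card_univ, ZMod.card]
  push_cast
  module

end MajumdarGhosh

theorem Matrix.IsHermitian.exists_eigenvalues_eq_of_mulVec {n : Type*} [Fintype n] [DecidableEq n]
    {A : Matrix n n ℂ} (hA : A.IsHermitian) {v : n → ℂ} (hv : v ≠ 0) {μ : ℝ}
    (h : A *ᵥ v = (μ : ℂ) • v) : ∃ i, hA.eigenvalues i = μ := by
  have : μ ∈ spectrum ℝ A := by
    have : (μ : ℂ) ∈ spectrum ℂ A := by
      rw [← spectrum_toLin']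
      exact (Module.End.hasEigenvalue_of_hasEigenvector
        ⟨Module.End.mem_eigenspace_iff.mpr (by simpa using h), hv⟩).mem_spectrum
    exact spectrum.of_algebraMap_mem ℂ this
  rwa [hA.spectrum_real_eq_range_eigenvalues] at this

theorem Matrix.IsHermitian.eigenvalues_le_of_posSemidef {n : Type*} [Fintype n] [DecidableEq n]
    {A : Matrix n n ℂ} (hA : A.IsHermitian) {c : ℝ}
    (h : ((c : ℂ) • (1 : Matrix n n ℂ) - A).PosSemidef) (i : n) : hA.eigenvalues i ≤ c := by
  set v : n → ℂ := ⇑(hA.eigenvectorBasis i)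
  have h1 : A *ᵥ v = (hA.eigenvalues i : ℂ) • v := by
    simpa using hA.mulVec_eigenvectorBasis i
  have hv : v ≠ 0 := fun h0 => hA.eigenvectorBasis.toBasis.ne_zero i (by
    ext j
    simpa using congrFun h0 j)
  have h2 := h.dotProduct_mulVec_nonneg v
  rw [sub_mulVec, smul_mulVec, one_mulVec, h1, ← sub_smul, dotProduct_smul, smul_eq_mul] at h2
  have h3 := (dotProduct_star_self_pos_iff (v := v)).mpr hv
  have h4 := (Complex.nonneg_iff.mp h2).1
  rw [← Complex.ofReal_sub, Complex.re_ofReal_mul] at h4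
  have h5 := nonneg_of_mul_nonneg_left h4 (Complex.pos_iff.mp h3).1
  linarith

/-- Level-1 sum-of-squares identity for the Majumdar–Ghosh chain:
`(3L/4)·I − H = Σ_k (3/4)·(I − (2/3)(H_{k,k+1} + H_{k+1,k+2} + H_{k,k+2}))²`.
In particular `λ_max(H) ≤ 3L/4`, with equality for even `L`. -/
theorem stmt18 (L : ℕ) [NeZero L] (hL : 5 ≤ L) (hH : (mgHam L).IsHermitian) :
    ((((3 * (L : ℝ) / 4 : ℝ)) : ℂ) • (1 : Matrix (ZMod L → Fin 2) (ZMod L → Fin 2) ℂ)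
        - mgHam L
      = ∑ k : ZMod L, ((3/4 : ℝ) : ℂ) •
          ((1 : Matrix (ZMod L → Fin 2) (ZMod L → Fin 2) ℂ)
            - ((2/3 : ℝ) : ℂ) •
                (singletProj k (k + 1) + singletProj (k + 1) (k + 2)
                  + singletProj k (k + 2))) ^ 2) ∧
    (⨆ y, hH.eigenvalues y) ≤ 3 * (L : ℝ) / 4 ∧
    (Even L → (⨆ y, hH.eigenvalues y) = 3 * (L : ℝ) / 4) := by
  have hle (y) : hH.eigenvalues y ≤ 3 * (L : ℝ) / 4 :=
    hH.eigenvalues_le_of_posSemidef (posSemidef_smul_one_sub_mgHam hL) y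
  refine ⟨smul_one_sub_mgHam hL, ciSup_le hle, fun hE => le_antisymm (ciSup_le hle) ?_⟩
  obtain ⟨y, hy⟩ := hH.exists_eigenvalues_eq_of_mulVec (dimerState_ne_zero hE.two_dvd)
    (mgHam_mulVec_dimerState hL hE.two_dvd)
  exact hy ▸ le_ciSup (Set.finite_range _).bddAbove y

end
end
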